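/- arXiv:2510.21017 — 2 statements merged into one kernel-verified Lean document; each statement's English description precedes it below -/
import Mathlib

section
/- Let (Ω, ℱ, P) be a probability space, let 𝒮 be a finite type with at least two elements, let S : Ω → 𝒮 be a measurable random variable with Pr(S = s) > 0 for every s ∈ 𝒮, and let Ŷ : Ω → ℝ be a measurable random variable taking values in {0,1}. For each pair i ≠ j in 𝒮, let E_{i,j} := {S ∈ {i, j}} and let S'_{i,j} : Ω → ℝ be the indicator of {S = j}. Then the multiclass demographic disparity satisfies max_{i ≠ j} |Pr(Ŷ = 1 | S = i) − Pr(Ŷ = 1 | S = j)| = max_{i ≠ j} (2 + Pr(S = i)/Pr(S = j) + Pr(S = j)/Pr(S = i)) · |Cov(Ŷ, S'_{i,j} | E_{i,j})|. -/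
open MeasureTheory

theorem abs_sub_eq_weight_mul_abs_cov {a b x y : ℝ} (ha : 0 < a) (hb : 0 < b) :
    |x / a - y / b| =
      (2 + a / b + b / a) * |y / (a + b) - (x + y) / (a + b) * (b / (a + b))| := by
  have hw : 0 ≤ 2 + a / b + b / a := by positivity
  nth_rewrite 1 [← abs_of_nonneg hw]
  rw [← abs_mul, abs_sub_comm]
  congr 1
  field_simp
  ring

theorem setIntegral_eq_toReal_measure_inter {Ω : Type*} [MeasurableSpace Ω] (μ : Measure Ω)
    {E A : Set Ω} (hA : MeasurableSet A) {f : Ω → ℝ} (h₁ : ∀ ω ∈ A, f ω = 1)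
    (h₀ : ∀ ω ∉ A, f ω = 0) :
    ∫ ω in E, f ω ∂μ = (μ (A ∩ E)).toReal := by
  have hf : f = A.indicator 1 := by
    ext ω
    by_cases h : ω ∈ A
    · simp [h, h₁ ω h]
    · simp [h, h₀ ω h]
  rw [hf, integral_indicator_one hA, measureReal_restrict_apply hA, Measure.real]

/-- Let `S` be a random variable valued in a finite type `𝒮` with at least two elements,
with every class of positive probability, and let `Ŷ` be a `{0,1}`-valued random
variable.  For each pair `i ≠ j` let `E_{i,j} = {S ∈ {i,j}}` and let `S'_{i,j}` be the
indicator of `{S = j}`.  Then the multiclass demographic disparity satisfies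
`max_{i ≠ j} |Pr(Ŷ=1|S=i) − Pr(Ŷ=1|S=j)|
  = max_{i ≠ j} (2 + Pr(S=i)/Pr(S=j) + Pr(S=j)/Pr(S=i)) · |Cov(Ŷ, S'_{i,j} | E_{i,j})|`,
where `Cov(X, Y | E) = E[XY·1_E]/P(E) − (E[X·1_E]/P(E))·(E[Y·1_E]/P(E))`, and the maxima
range over the (finite, nonempty) set of pairs `(i, j)` with `i ≠ j`. -/
theorem multiclass_demographic_disparity_eq_max_weighted_cond_cov
    {Ω : Type*} [MeasurableSpace Ω] (μ : Measure Ω) [IsProbabilityMeasure μ]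
    {𝒮 : Type*} [Fintype 𝒮] [Nontrivial 𝒮] [DecidableEq 𝒮] [MeasurableSpace 𝒮] [MeasurableSingletonClass 𝒮]
    (S : Ω → 𝒮) (hSm : Measurable S)
    (hSpos : ∀ s : 𝒮, 0 < (μ {ω | S ω = s}).toReal)
    (Yhat : Ω → ℝ) (hYm : Measurable Yhat) (hY01 : ∀ ω, Yhat ω = 0 ∨ Yhat ω = 1) :
    (⨆ p : {p : 𝒮 × 𝒮 // p.1 ≠ p.2},
      |(μ {ω | Yhat ω = 1 ∧ S ω = p.1.1}).toReal / (μ {ω | S ω = p.1.1}).toReal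
        - (μ {ω | Yhat ω = 1 ∧ S ω = p.1.2}).toReal / (μ {ω | S ω = p.1.2}).toReal|)
    = ⨆ p : {p : 𝒮 × 𝒮 // p.1 ≠ p.2},
        (2 + (μ {ω | S ω = p.1.1}).toReal / (μ {ω | S ω = p.1.2}).toReal
           + (μ {ω | S ω = p.1.2}).toReal / (μ {ω | S ω = p.1.1}).toReal)
        * |(∫ ω in {ω | S ω = p.1.1 ∨ S ω = p.1.2},
              Yhat ω * (if S ω = p.1.2 then (1 : ℝ) else 0) ∂μ)
              / (μ {ω | S ω = p.1.1 ∨ S ω = p.1.2}).toReal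
            - ((∫ ω in {ω | S ω = p.1.1 ∨ S ω = p.1.2}, Yhat ω ∂μ)
                  / (μ {ω | S ω = p.1.1 ∨ S ω = p.1.2}).toReal)
              * ((∫ ω in {ω | S ω = p.1.1 ∨ S ω = p.1.2},
                    (if S ω = p.1.2 then (1 : ℝ) else 0) ∂μ)
                  / (μ {ω | S ω = p.1.1 ∨ S ω = p.1.2}).toReal)| := by
  have hSi (s : 𝒮) : MeasurableSet {ω | S ω = s} := hSm (measurableSet_singleton s)
  have hY : MeasurableSet {ω | Yhat ω = 1} := hYm (measurableSet_singleton 1)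
  have hY₀ (ω : Ω) (h : Yhat ω ≠ 1) : Yhat ω = 0 := (hY01 ω).resolve_right h
  refine iSup_congr fun ⟨⟨i, j⟩, hij⟩ => ?_
  dsimp only at hij ⊢
  have hE : (μ {ω | S ω = i ∨ S ω = j}).toReal =
      (μ {ω | S ω = i}).toReal + (μ {ω | S ω = j}).toReal := by
    refine measureReal_union (μ := μ) (Set.disjoint_left.2 ?_) (hSi j)
    exact fun ω h h' => hij (h.symm.trans h')
  have hYE : ∫ ω in {ω | S ω = i ∨ S ω = j}, Yhat ω ∂μ =
      (μ {ω | Yhat ω = 1 ∧ S ω = i}).toReal + (μ {ω | Yhat ω = 1 ∧ S ω = j}).toReal := by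
    rw [setIntegral_eq_toReal_measure_inter μ hY (fun _ h => h) hY₀]
    have hU : {ω | Yhat ω = 1} ∩ {ω | S ω = i ∨ S ω = j} =
        {ω | Yhat ω = 1 ∧ S ω = i} ∪ {ω | Yhat ω = 1 ∧ S ω = j} := Set.inter_union_distrib_left ..
    rw [hU]
    refine measureReal_union (μ := μ) (Set.disjoint_left.2 ?_) (hY.inter (hSi j))
    exact fun ω h h' => hij (h.2.symm.trans h'.2)
  have hj : {ω | S ω = j} ⊆ {ω | S ω = i ∨ S ω = j} := fun _ => Or.inr
  have hSE : ∫ ω in {ω | S ω = i ∨ S ω = j}, (if S ω = j then (1 : ℝ) else 0) ∂μ =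
      (μ {ω | S ω = j}).toReal := by
    rw [setIntegral_eq_toReal_measure_inter μ (hSi j), Set.inter_eq_left.2 hj]
    · exact fun _ h => if_pos h
    · exact fun _ h => if_neg h
  have hYS : ∫ ω in {ω | S ω = i ∨ S ω = j}, Yhat ω * (if S ω = j then (1 : ℝ) else 0) ∂μ =
      (μ {ω | Yhat ω = 1 ∧ S ω = j}).toReal := by
    rw [setIntegral_eq_toReal_measure_inter μ (A := {ω | Yhat ω = 1 ∧ S ω = j})
      (hY.inter (hSi j)), Set.inter_eq_left.2 fun _ h => hj h.2]
    · rintro ω ⟨h, h'⟩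
      simp [h, h']
    · intro ω h
      by_cases h' : S ω = j
      · simp [hY₀ ω fun h₁ => h ⟨h₁, h'⟩]
      · simp [h']
  rw [hE, hYE, hSE, hYS]
  exact abs_sub_eq_weight_mul_abs_cov (hSpos i) (hSpos j)
end

section
/- Let (Ω, ℱ, P) be a probability space, let 𝒮 be a finite nonempty type with cardinality k, let δ ∈ (0,1) and ε ∈ ℝ. Let q : 𝒮 × 𝒮 → ℝ be fixed real numbers and let c_l, c_u : 𝒮 × 𝒮 → Ω → ℝ be measurable random variables such that for every (s, j) ∈ 𝒮 × 𝒮, Pr(q(s,j) ≤ c_l(s,j)) ≤ δ/(2k²) and Pr(q(s,j) ≥ c_u(s,j)) ≤ δ/(2k²). Let g ∈ ℝ be any real number satisfying g ≤ max_{s ∈ 𝒮} (max_{j ∈ 𝒮} q(s,j) − min_{j' ∈ 𝒮} q(s,j')) − ε. Then Pr( g ≤ max_{s ∈ 𝒮} (max_{j ∈ 𝒮} c_u(s,j) − min_{j' ∈ 𝒮} c_l(s,j')) − ε ) ≥ 1 − δ. -/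
open MeasureTheory

/-- The largest spread of the rows of a finite matrix is monotone in the upper entries and
antitone in the lower entries. -/
theorem iSup_iSup_sub_iInf_mono {ι κ : Type*} [Finite ι] [Nonempty ι] [Finite κ] [Nonempty κ]
    {a b c d : ι → κ → ℝ} (hac : ∀ i j, a i j ≤ c i j) (hdb : ∀ i j, d i j ≤ b i j) :
    (⨆ i, ((⨆ j, a i j) - ⨅ j, b i j)) ≤ ⨆ i, ((⨆ j, c i j) - ⨅ j, d i j) :=
  ciSup_mono (Set.finite_range _).bddAbove fun i =>
    sub_le_sub (ciSup_mono (Set.finite_range _).bddAbove (hac i))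
      (ciInf_mono (Set.finite_range _).bddBelow (hdb i))

/-- High-confidence upper bound for the multiclass fairness test: if each entrywise
confidence bound `c_l (s,j)` / `c_u (s,j)` for the true conditional probability
`q (s,j)` fails on each side with probability at most `δ/(2k²)` (where `k` is the
number of classes), and `g ≤ max_s (max_j q(s,j) − min_{j'} q(s,j')) − ε`, then with
probability at least `1 − δ` we have
`g ≤ max_s (max_j c_u(s,j) − min_{j'} c_l(s,j')) − ε`. -/
theorem multiclass_fairness_test_confidence_bound
    {Ω : Type*} [MeasurableSpace Ω] (μ : Measure Ω) [IsProbabilityMeasure μ]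
    {𝒮 : Type*} [Fintype 𝒮] [Nonempty 𝒮] (k : ℕ) (hk : Fintype.card 𝒮 = k)
    (δ : ℝ) (hδ0 : 0 < δ) (hδ1 : δ < 1) (ε : ℝ)
    (q : 𝒮 → 𝒮 → ℝ) (cl cu : 𝒮 → 𝒮 → Ω → ℝ)
    (hcl : ∀ s j, Measurable (cl s j)) (hcu : ∀ s j, Measurable (cu s j))
    (hl : ∀ s j, (μ {ω | q s j ≤ cl s j ω}).toReal ≤ δ / (2 * (k : ℝ) ^ 2))
    (hu : ∀ s j, (μ {ω | cu s j ω ≤ q s j}).toReal ≤ δ / (2 * (k : ℝ) ^ 2))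
    (g : ℝ) (hg : g ≤ (⨆ s, ((⨆ j, q s j) - ⨅ j', q s j')) - ε) :
    1 - δ ≤ (μ {ω | g ≤ (⨆ s, ((⨆ j, cu s j ω) - ⨅ j', cl s j' ω)) - ε}).toReal := by
  change 1 - δ ≤ μ.real _
  set good := {ω | g ≤ (⨆ s, ((⨆ j, cu s j ω) - ⨅ j', cl s j' ω)) - ε}
  set bad : 𝒮 × 𝒮 → Set Ω := fun p =>
    {ω | q p.1 p.2 ≤ cl p.1 p.2 ω} ∪ {ω | cu p.1 p.2 ω ≤ q p.1 p.2}
  have hk0 : (k : ℝ) ≠ 0 := by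
    rw [← hk]
    exact_mod_cast Fintype.card_ne_zero
  have hbad : μ.real (⋃ p, bad p) ≤ δ := by
    calc μ.real (⋃ p, bad p) ≤ ∑ p, μ.real (bad p) := measureReal_iUnion_fintype_le _
      _ ≤ ∑ _p : 𝒮 × 𝒮, (δ / (2 * (k : ℝ) ^ 2) + δ / (2 * (k : ℝ) ^ 2)) :=
        Finset.sum_le_sum fun p _ =>
          (measureReal_union_le _ _).trans (add_le_add (hl p.1 p.2) (hu p.1 p.2))
      _ = δ := by
        simp only [Finset.sum_const, Finset.card_univ, Fintype.card_prod, hk, nsmul_eq_mul,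
          Nat.cast_mul]
        field_simp
        ring
  have hcover : Set.univ ⊆ good ∪ ⋃ p, bad p := by
    intro ω _
    by_cases hω : ω ∈ ⋃ p, bad p
    · exact Or.inr hω
    · have hbounds : ∀ s j, cl s j ω < q s j ∧ q s j < cu s j ω := by
        simpa [bad] using hω
      exact Or.inl (hg.trans (sub_le_sub_right
        (iSup_iSup_sub_iInf_mono (fun s j => (hbounds s j).2.le)
          (fun s j => (hbounds s j).1.le)) ε))
  have hone : 1 ≤ μ.real good + μ.real (⋃ p, bad p) :=
    calc 1 = μ.real Set.univ := probReal_univ.symm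
      _ ≤ μ.real (good ∪ ⋃ p, bad p) := measureReal_mono hcover
      _ ≤ _ := measureReal_union_le _ _
  linarith
end
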